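/- arXiv:math/0508634 — 4 statements merged into one kernel-verified Lean document; each statement's English description precedes it below -/
import Mathlib

section
/- Let V be a real normed vector space, ω : V × V → ℝ a continuous alternating bilinear form, and ξ : V → V a continuous linear map with ω(ξx, y) + ω(x, ξy) = 0 for all x, y ∈ V. Let h : V → ℝ be differentiable, and suppose h is infinitesimally invariant under ξ: Dh(v)(ξv) = 0 for all v ∈ V. Let X : V → V be a vector field satisfying the Hamiltonian condition ω(X(v), w) = Dh(v)(w) for all v, w ∈ V, and let γ : ℝ → V be a curve with derivative γ'(t) = X(γ(t)) for all t. Then the function t ↦ (1/2)·ω(ξ(γ(t)), γ(t)) is constant on ℝ. -/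
/-- **Noether's theorem (linear version).** Let `ω` be a continuous alternating bilinear form
on a real normed space `V`, `ξ` an infinitesimally symplectic continuous linear map, `h` a
differentiable Hamiltonian that is infinitesimally invariant under `ξ` (`Dh(v)(ξv) = 0`),
`X` a vector field with `ω(X(v), w) = Dh(v)(w)`, and `γ` an integral curve of `X`. Then the
momentum function `t ↦ (1/2) ω(ξ(γ(t)), γ(t))` is constant. -/
theorem noether_momentum_conserved
    (V : Type*) [NormedAddCommGroup V] [NormedSpace ℝ V]
    (ω : V →L[ℝ] V →L[ℝ] ℝ)
    (halt : ∀ v : V, ω v v = 0)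
    (ξ : V →L[ℝ] V)
    (hξ : ∀ x y : V, ω (ξ x) y + ω x (ξ y) = 0)
    (h : V → ℝ) (hdiff : Differentiable ℝ h)
    (hinv : ∀ v : V, fderiv ℝ h v (ξ v) = 0)
    (X : V → V)
    (hX : ∀ v w : V, ω (X v) w = fderiv ℝ h v w)
    (γ : ℝ → V)
    (hγ : ∀ t : ℝ, HasDerivAt γ (X (γ t)) t) :
    ∀ t s : ℝ, (1 / 2 : ℝ) * ω (ξ (γ t)) (γ t) = (1 / 2 : ℝ) * ω (ξ (γ s)) (γ s) := by
  have horth (v : V) : ω (X v) (ξ v) = 0 := by rw [hX, hinv]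
  have hzero (v : V) : ω (ξ (X v)) v = 0 := by linarith [hξ (X v) v, horth v]
  have hzero' (v : V) : ω (ξ v) (X v) = 0 := by
    have hadd := halt (ξ v + X v)
    simp only [map_add, add_apply, halt, horth] at hadd
    linarith
  have hderiv (t : ℝ) : HasDerivAt (fun t => ω (ξ (γ t)) (γ t)) 0 t := by
    have hξγ : HasDerivAt (fun t => ω (ξ (γ t))) (ω (ξ (X (γ t)))) t :=
      (ω.comp ξ).hasFDerivAt.comp_hasDerivAt t (hγ t)
    simpa [hzero, hzero'] using hξγ.clm_apply (hγ t)
  intro t s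
  rw [is_const_of_deriv_eq_zero (fun t => (hderiv t).differentiableAt)
    (fun t => (hderiv t).deriv) t s]
end

section
/- Let 𝔤 be a real Lie algebra, Σ : 𝔤 × 𝔤 → ℝ a skew-symmetric bilinear form, and ν ∈ 𝔤*. For ξ ∈ 𝔤 define ξ_{𝔤*}(ν) := −ν∘ad_ξ + Σ(ξ, ·) ∈ 𝔤*, and let T := {ξ_{𝔤*}(ν) : ξ ∈ 𝔤} ⊆ 𝔤* (a linear subspace, since ξ ↦ ξ_{𝔤*}(ν) is linear). Then: (a) if ξ, ξ', η, η' ∈ 𝔤 satisfy ξ_{𝔤*}(ν) = ξ'_{𝔤*}(ν) and η_{𝔤*}(ν) = η'_{𝔤*}(ν), then ⟨ν, [ξ, η]⟩ − Σ(ξ, η) = ⟨ν, [ξ', η']⟩ − Σ(ξ', η'); hence there is a well-defined bilinear form B on T with B(ξ_{𝔤*}(ν), η_{𝔤*}(ν)) = ⟨ν, [ξ, η]⟩ − Σ(ξ, η); (b) B is skew-symmetric; (c) B is nondegenerate on T: if u ∈ T satisfies B(u, w) = 0 for all w ∈ T, then u = 0. -/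
/-- **The Kostant–Kirillov–Souriau form on an affine coadjoint orbit.** Let `𝔤` be a real
Lie algebra, `Σ` a skew-symmetric bilinear form on `𝔤` and `ν ∈ 𝔤*`. For `ξ ∈ 𝔤` let
`ξ_{𝔤*}(ν) = −ν∘ad_ξ + Σ(ξ, ·)` be the infinitesimal generator of the affine action, whose
values span the tangent space `T` to the affine orbit at `ν`. Then
(a) `⟨ν, [ξ,η]⟩ − Σ(ξ,η)` depends only on `ξ_{𝔤*}(ν)` and `η_{𝔤*}(ν)`, so there is a
well-defined form `B` on `T` with `B(ξ_{𝔤*}(ν), η_{𝔤*}(ν)) = ⟨ν, [ξ,η]⟩ − Σ(ξ,η)`;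
(b) `B` is skew-symmetric on `T`; (c) `B` is nondegenerate on `T`. -/
theorem kks_form_well_defined_skew_nondegenerate
    (𝔤 : Type*) [LieRing 𝔤] [LieAlgebra ℝ 𝔤]
    (Sig : 𝔤 →ₗ[ℝ] 𝔤 →ₗ[ℝ] ℝ)
    (hskew : ∀ ξ η : 𝔤, Sig ξ η = - Sig η ξ)
    (ν : Module.Dual ℝ 𝔤)
    (gen : 𝔤 → Module.Dual ℝ 𝔤)
    (hgen : ∀ ξ : 𝔤, gen ξ = -(ν ∘ₗ (LieAlgebra.ad ℝ 𝔤 ξ)) + Sig ξ) :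
    -- (a) well-definedness
    (∀ ξ ξ' η η' : 𝔤, gen ξ = gen ξ' → gen η = gen η' →
        ν ⁅ξ, η⁆ - Sig ξ η = ν ⁅ξ', η'⁆ - Sig ξ' η') ∧
    (∃ B : Module.Dual ℝ 𝔤 → Module.Dual ℝ 𝔤 → ℝ,
      (∀ ξ η : 𝔤, B (gen ξ) (gen η) = ν ⁅ξ, η⁆ - Sig ξ η) ∧
      -- (b) skew-symmetry on T
      (∀ ξ η : 𝔤, B (gen ξ) (gen η) = - B (gen η) (gen ξ)) ∧
      -- (c) nondegeneracy on T
      (∀ ξ : 𝔤, (∀ η : 𝔤, B (gen ξ) (gen η) = 0) → gen ξ = 0)) := by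
  have apply_gen (ξ η : 𝔤) : gen ξ η = -(ν ⁅ξ, η⁆ - Sig ξ η) := by
    simp [hgen]
    ring
  have form_skew (ξ η : 𝔤) : ν ⁅ξ, η⁆ - Sig ξ η = -(ν ⁅η, ξ⁆ - Sig η ξ) := by
    rw [← lie_skew, map_neg, hskew ξ η]
    ring
  have form_congr (ξ ξ' η η' : 𝔤) (hξ : gen ξ = gen ξ') (hη : gen η = gen η') :
      ν ⁅ξ, η⁆ - Sig ξ η = ν ⁅ξ', η'⁆ - Sig ξ' η' := by
    have h₁ : gen ξ η = gen ξ' η := by rw [hξ]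
    have h₂ : gen η ξ' = gen η' ξ' := by rw [hη]
    rw [apply_gen, apply_gen] at h₁ h₂
    linarith [form_skew ξ' η, form_skew ξ' η']
  have form_eq (ξ η : 𝔤) : -(gen ξ (Function.invFun gen (gen η))) = ν ⁅ξ, η⁆ - Sig ξ η := by
    rw [apply_gen, neg_neg]
    exact form_congr _ _ _ _ rfl (Function.invFun_eq ⟨η, rfl⟩)
  refine ⟨form_congr, fun α β => -(α (Function.invFun gen β)), form_eq, fun ξ η => ?_,
    fun ξ h => ?_⟩
  · simp only [form_eq]
    exact form_skew ξ η
  · simp only [form_eq] at h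
    ext η
    rw [apply_gen, h, neg_zero, LinearMap.zero_apply]
end

section
/- Let V be a finite-dimensional real vector space, ω : V × V → ℝ an alternating bilinear form that is nondegenerate (if ω(v, w) = 0 for all w then v = 0), and 𝔤 ⊆ End(V) a linear subspace of endomorphisms each of which is infinitesimally symplectic (ω(ξx, y) + ω(x, ξy) = 0 for all x, y). Fix v ∈ V and let T_v : V → 𝔤* be the linear map T_v(w) := (ξ ↦ ω(ξv, w)), which is the derivative at v of the momentum map ⟨J(v), ξ⟩ = (1/2)ω(ξv, v). Let 𝔤_v := {ξ ∈ 𝔤 : ξv = 0} be the isotropy subalgebra of v. Then the range of T_v equals the annihilator (𝔤_v)° := {μ ∈ 𝔤* : μ(ξ) = 0 for all ξ ∈ 𝔤_v}. -/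
/-- **The bifurcation lemma for the linear momentum map.** Let `(V, ω)` be a
finite-dimensional symplectic vector space and `𝔤 ⊆ End(V)` a subspace of infinitesimally
symplectic endomorphisms. Fix `v ∈ V` and let `T_v : V → 𝔤*`, `T_v(w) = (ξ ↦ ω(ξv, w))`,
be the derivative at `v` of the momentum map `⟨J(v), ξ⟩ = (1/2) ω(ξv, v)`. Then
`range T_v = (𝔤_v)°`, the annihilator of the isotropy subalgebra `𝔤_v = {ξ ∈ 𝔤 : ξv = 0}`. -/
theorem bifurcation_lemma_linear
    (V : Type*) [AddCommGroup V] [Module ℝ V] [FiniteDimensional ℝ V]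
    (ω : V →ₗ[ℝ] V →ₗ[ℝ] ℝ)
    (halt : ∀ v : V, ω v v = 0)
    (hnondeg : ∀ v : V, (∀ w : V, ω v w = 0) → v = 0)
    (𝔤 : Submodule ℝ (V →ₗ[ℝ] V))
    (h𝔤 : ∀ ξ ∈ 𝔤, ∀ x y : V, ω (ξ x) y + ω x (ξ y) = 0)
    (v : V)
    (Tv : V →ₗ[ℝ] Module.Dual ℝ 𝔤)
    (hTv : ∀ (w : V) (ξ : 𝔤), Tv w ξ = ω ((ξ : V →ₗ[ℝ] V) v) w) :
    (LinearMap.range Tv : Set (Module.Dual ℝ 𝔤)) =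
      {μ : Module.Dual ℝ 𝔤 | ∀ ξ : 𝔤, (ξ : V →ₗ[ℝ] V) v = 0 → μ ξ = 0} := by
  have hsurj : Function.Surjective ω := by
    refine (LinearMap.injective_iff_surjective_of_finrank_eq_finrank
      Subspace.dual_finrank_eq.symm).1 ((injective_iff_map_eq_zero ω).2 fun x hx => ?_)
    exact hnondeg x fun w => by rw [hx, LinearMap.zero_apply]
  let orbit : 𝔤 →ₗ[ℝ] V := (LinearMap.applyₗ v).comp 𝔤.subtype
  ext μ
  constructor
  · rintro ⟨w, rfl⟩ ξ hξ
    rw [hTv, hξ, map_zero, LinearMap.zero_apply]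
  · intro hμ
    have hmem : μ ∈ LinearMap.range orbit.dualMap := by
      rw [LinearMap.range_dualMap_eq_dualAnnihilator_ker, Submodule.mem_dualAnnihilator]
      exact fun ξ hξ => hμ ξ hξ
    obtain ⟨φ, rfl⟩ := hmem
    obtain ⟨w, rfl⟩ := hsurj φ
    refine ⟨-w, LinearMap.ext fun ξ => ?_⟩
    rw [hTv, map_neg]
    exact LinearMap.IsAlt.neg halt _ _
end

section
/- Let V be a real normed vector space, ω : V × V → ℝ a continuous bilinear form, 𝔤 a real Lie algebra, and φ : 𝔤 → L(V, V) a map assigning to each ξ ∈ 𝔤 a continuous linear map φ(ξ) : V → V. Suppose J₁, J₂ : V → 𝔤* both satisfy, for every ξ ∈ 𝔤: (momentum map condition) the function v ↦ ⟨J_i(v), ξ⟩ is differentiable with Fréchet derivative at v equal to w ↦ ω(φ(ξ)v, w); and (infinitesimal equivariance) ⟨J_i(v), [ξ, η]⟩ = ω(φ(ξ)v, φ(η)v) for all η ∈ 𝔤 and v ∈ V. If 𝔤 is perfect, i.e., 𝔤 = [𝔤, 𝔤] (the derived subalgebra is all of 𝔤), then J₁ = J₂. -/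
/-- Linear maps on a perfect Lie algebra that agree on all brackets are equal. -/
theorem LinearMap.ext_lie_of_perfect {R L M : Type*} [CommRing R] [LieRing L] [LieAlgebra R L]
    [AddCommMonoid M] [Module R M] (hperfect : LieAlgebra.derivedSeries R L 1 = ⊤)
    {f g : L →ₗ[R] M} (h : ∀ x y : L, f ⁅x, y⁆ = g ⁅x, y⁆) : f = g := by
  have hbracket : ⁅(⊤ : LieIdeal R L), (⊤ : LieIdeal R L)⁆ = ⊤ := by
    simpa [LieAlgebra.derivedSeries_def] using hperfect
  have hspan := congrArg LieSubmodule.toSubmodule hbracket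
  rw [LieSubmodule.lieIdeal_oper_eq_linear_span', LieSubmodule.top_toSubmodule] at hspan
  refine LinearMap.ext_on hspan ?_
  rintro _ ⟨x, -, y, -, rfl⟩
  exact h x y

/-- **Uniqueness of the infinitesimally equivariant momentum map for perfect Lie algebras.**
Let `ω` be a continuous bilinear form on a real normed space `V`, `𝔤` a real Lie algebra,
and `φ : 𝔤 → L(V,V)` an assignment of continuous linear maps. If `J₁, J₂ : V → 𝔤*` both
satisfy the momentum map condition (`D⟨Jᵢ(·), ξ⟩(v) = ω(φ(ξ)v, ·)`) and infinitesimal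
equivariance (`⟨Jᵢ(v), [ξ,η]⟩ = ω(φ(ξ)v, φ(η)v)`), and `𝔤` is perfect (`𝔤 = [𝔤, 𝔤]`),
then `J₁ = J₂`. -/
theorem momentum_map_unique_of_perfect
    (V : Type*) [NormedAddCommGroup V] [NormedSpace ℝ V]
    (ω : V →L[ℝ] V →L[ℝ] ℝ)
    (𝔤 : Type*) [LieRing 𝔤] [LieAlgebra ℝ 𝔤]
    (φ : 𝔤 → (V →L[ℝ] V))
    (J₁ J₂ : V → Module.Dual ℝ 𝔤)
    (hJ₁mom : ∀ (ξ : 𝔤) (v : V),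
      HasFDerivAt (fun w : V => J₁ w ξ) (ω (φ ξ v)) v)
    (hJ₂mom : ∀ (ξ : 𝔤) (v : V),
      HasFDerivAt (fun w : V => J₂ w ξ) (ω (φ ξ v)) v)
    (hJ₁equiv : ∀ (ξ η : 𝔤) (v : V), J₁ v ⁅ξ, η⁆ = ω (φ ξ v) (φ η v))
    (hJ₂equiv : ∀ (ξ η : 𝔤) (v : V), J₂ v ⁅ξ, η⁆ = ω (φ ξ v) (φ η v))
    (hperfect : LieAlgebra.derivedSeries ℝ 𝔤 1 = ⊤) :
    J₁ = J₂ := by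
  funext v
  exact LinearMap.ext_lie_of_perfect hperfect fun ξ η =>
    (hJ₁equiv ξ η v).trans (hJ₂equiv ξ η v).symm
end
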